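/- arXiv:2604.24087 — 2 statements merged into one kernel-verified Lean document; each statement's English description precedes it below -/
import Mathlib

section
/- For every integer n ≥ 3 and every complex n × 2 matrix U with orthonormal columns (U^H U = I₂), there exist indices i ≠ j such that the 2 × 2 submatrix U_{ij} formed by rows i and j of U is invertible and the spectral norm (operator 2-norm) of its inverse satisfies ‖U_{ij}⁻¹‖₂ ≤ √(n/α), where α = 2 − 2/√3. -/
open Matrix

/-- Basic solutions of a linear program: nonnegative weights with a prescribed total and a prescribed
weighted sum in `Fin d → ℝ` can be moved to at most `d + 1` points without decreasing a given linear
objective. -/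
lemma exists_weights_card_support_le {ι : Type*} [Fintype ι] [DecidableEq ι] {d : ℕ}
    (v : ι → Fin d → ℝ) (r : ι → ℝ) (p₀ : ι → ℝ) (hp₀ : ∀ i, 0 ≤ p₀ i) :
    ∃ p : ι → ℝ, (∀ i, 0 ≤ p i) ∧ ∑ i, p i = ∑ i, p₀ i ∧
      ∑ i, p i • v i = ∑ i, p₀ i • v i ∧ ∑ i, p₀ i * r i ≤ ∑ i, p i * r i ∧
      (Finset.univ.filter fun i => p i ≠ 0).card ≤ d + 1 := by
  induction hm : (Finset.univ.filter fun i => p₀ i ≠ 0).card using Nat.strong_induction_on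
    generalizing p₀ with
  | _ m ih =>
  by_cases hcard : m ≤ d + 1
  · exact ⟨p₀, hp₀, rfl, rfl, le_rfl, hm ▸ hcard⟩
  push Not at hcard
  set S := Finset.univ.filter fun i => p₀ i ≠ 0 with hS
  have hdep : ¬ LinearIndependent ℝ fun i : S => ((1 : ℝ), v i) := by
    intro h
    have := h.fintype_card_le_finrank
    simp at this
    omega
  obtain ⟨c, hc, i₁, hi₁⟩ := Fintype.not_linearIndependent_iff.1 hdep
  obtain ⟨e, heS, he1, hev, her, hne⟩ : ∃ e : ι → ℝ, (∀ i, p₀ i = 0 → e i = 0) ∧ ∑ i, e i = 0 ∧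
      ∑ i, e i • v i = 0 ∧ 0 ≤ ∑ i, e i * r i ∧ ∃ i, e i ≠ 0 := by
    obtain ⟨e, heS, he1, hev, hne⟩ : ∃ e : ι → ℝ, (∀ i, p₀ i = 0 → e i = 0) ∧ ∑ i, e i = 0 ∧
        ∑ i, e i • v i = 0 ∧ ∃ i, e i ≠ 0 := by
      refine ⟨fun i => if h : i ∈ S then c ⟨i, h⟩ else 0, ?_, ?_, ?_, i₁, ?_⟩
      · intro i hi
        simp [hS, hi]
      · have := congrArg Prod.fst hc
        simp only [Prod.fst_sum, Prod.smul_fst, smul_eq_mul, mul_one, Prod.fst_zero] at this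
        rw [← Finset.sum_subset (Finset.subset_univ S) (by
          intro x _ hx; simp [hx]), ← Finset.sum_coe_sort S]
        simpa using this
      · have := congrArg Prod.snd hc
        simp only [Prod.snd_sum, Prod.smul_snd, Prod.snd_zero] at this
        rw [← Finset.sum_subset (Finset.subset_univ S) (by
          intro x _ hx; simp [hx]), ← Finset.sum_coe_sort S]
        simpa using this
      · simpa using hi₁
    rcases le_total 0 (∑ i, e i * r i) with h | h
    · exact ⟨e, heS, he1, hev, h, hne⟩
    · refine ⟨-e, fun i hi => by simp [heS i hi], by simp [he1], by simp [hev], by simpa using h, ?_⟩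
      simpa using hne
  have hneg : ∃ i, e i < 0 := by
    by_contra! h
    obtain ⟨i, hi⟩ := hne
    exact hi ((Finset.sum_eq_zero_iff_of_nonneg fun i _ => h i).1 he1 i (Finset.mem_univ i))
  obtain ⟨k, hk, hmin⟩ := Finset.exists_min_image (Finset.univ.filter fun i => e i < 0)
    (fun i => p₀ i / -e i) (by simpa [Finset.Nonempty] using hneg)
  simp only [Finset.mem_filter, Finset.mem_univ, true_and] at hk hmin
  set t := p₀ k / -e k with ht
  have ht0 : 0 ≤ t := div_nonneg (hp₀ k) (by linarith)
  have hq : ∀ i, 0 ≤ p₀ i + t * e i := by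
    intro i
    rcases lt_or_ge (e i) 0 with hi | hi
    · have := (le_div_iff₀ (by linarith : 0 < -e i)).1 (hmin i hi)
      linarith
    · exact add_nonneg (hp₀ i) (mul_nonneg ht0 hi)
  have hlt : (Finset.univ.filter fun i => p₀ i + t * e i ≠ 0).card < m := by
    rw [← hm]
    apply Finset.card_lt_card
    refine Finset.ssubset_iff_of_subset ?_ |>.2 ⟨k, ?_, ?_⟩
    · intro i
      simp only [hS, Finset.mem_filter, Finset.mem_univ, true_and]
      intro h h0
      exact h (by simp [h0, heS i h0])
    · simp only [hS, Finset.mem_filter, Finset.mem_univ, true_and]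
      exact fun h => hk.ne (heS k h)
    · simp only [Finset.mem_filter, Finset.mem_univ, true_and, not_not, ht]
      field_simp [hk.ne]
      ring
  obtain ⟨p, h0, h1, h2, h3, h4⟩ := ih _ hlt _ hq rfl
  refine ⟨p, h0, ?_, ?_, ?_, h4⟩
  · rw [h1, Finset.sum_add_distrib, ← Finset.mul_sum, he1]; simp
  · rw [h2]
    simp only [add_smul, mul_smul, Finset.sum_add_distrib, ← Finset.smul_sum, hev]
    simp
  · refine le_trans ?_ h3
    simp only [add_mul, mul_assoc, Finset.sum_add_distrib, ← Finset.mul_sum]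
    linarith [mul_nonneg ht0 her]

/-- Among at most four vectors of `Fin d → ℝ` with Euclidean lengths `r i`, whose average with
positive weights is zero while their average length is one, two have lengths at least `b` and
satisfy `|v i| + |v j| - |v i + v j| ≥ 2 b` (in squared form), where `b = 1 - 1 / √3` is the value
attained by the regular tetrahedron. -/
lemma exists_pair_of_card_le_four {ι : Type*} [DecidableEq ι] {d : ℕ} (S : Finset ι)
    (hS : S.card ≤ 4) (v : ι → Fin d → ℝ) (r p : ι → ℝ) (hr : ∀ i, 0 ≤ r i)
    (hrv : ∀ i, r i ^ 2 = v i ⬝ᵥ v i) (hp : ∀ i ∈ S, 0 < p i) (hp1 : ∑ i ∈ S, p i = 1)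
    (hpv : ∑ i ∈ S, p i • v i = 0) (hpr : ∑ i ∈ S, p i * r i = 1)
    {b : ℝ} (hb0 : 0 < b) (hb1 : b < 1 / 2) (hb : 3 * (1 - b) ^ 2 = 1) :
    ∃ i ∈ S, ∃ j ∈ S, i ≠ j ∧ b ≤ r i ∧ b ≤ r j ∧
      2 * b * (r i + r j) - 2 * b ^ 2 ≤ r i * r j - v i ⬝ᵥ v j := by
  by_contra! hcon
  have hcs : ∀ i j, r i * r j - v i ⬝ᵥ v j ≤ 2 * (r i * r j) := by
    intro i j
    have h : (v i ⬝ᵥ v j) ^ 2 ≤ (r i * r j) ^ 2 := by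
      rw [mul_pow, hrv, hrv]
      simp only [dotProduct, ← pow_two]
      exact Finset.sum_mul_sq_le_sq_mul_sq _ _ _
    linarith [(abs_le_of_sq_le_sq' h (mul_nonneg (hr i) (hr j))).1]
  have key : ∀ k ∈ S, p k * r k < (1 - b) / 4 + b * p k := by
    intro k hk
    have hpk := hp k hk
    rcases le_or_gt (r k) b with hsmall | hbig
    · nlinarith
    have hlt : ∀ l ∈ S.erase k, p l * (r k * r l - v k ⬝ᵥ v l) <
        p l * (2 * b * (r k + r l) - 2 * b ^ 2) := by
      intro l hl
      obtain ⟨hlk, hl⟩ := Finset.mem_erase.1 hl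
      refine mul_lt_mul_of_pos_left ?_ (hp l hl)
      rcases le_or_gt b (r l) with h | h
      · exact hcon k hk l hl hlk.symm hbig.le h
      · nlinarith [hcs k l]
    have hvk : ∑ l ∈ S, p l * (v k ⬝ᵥ v l) = 0 := by
      have := congrArg (fun w => v k ⬝ᵥ w) hpv
      simpa [dotProduct_sum, dotProduct_smul] using this
    have hrow : r k = ∑ l ∈ S.erase k, p l * (r k * r l - v k ⬝ᵥ v l) := by
      have h : ∑ l ∈ S, p l * (r k * r l - v k ⬝ᵥ v l) = r k := by
        simp only [mul_sub, Finset.sum_sub_distrib, hvk, sub_zero, mul_left_comm _ (r k),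
          ← Finset.mul_sum, hpr, mul_one]
      rw [← Finset.add_sum_erase S _ hk, ← hrv, pow_two, sub_self, mul_zero, zero_add] at h
      exact h.symm
    have hbound : ∑ l ∈ S.erase k, p l * (2 * b * (r k + r l) - 2 * b ^ 2) =
        (2 * b * r k - 2 * b ^ 2) * (1 - p k) + 2 * b * (1 - p k * r k) := by
      have h1 : 1 - p k = ∑ l ∈ S.erase k, p l := by
        rw [← hp1, ← Finset.add_sum_erase S p hk, add_sub_cancel_left]
      have h2 : 1 - p k * r k = ∑ l ∈ S.erase k, p l * r l := by
        rw [← hpr, ← Finset.add_sum_erase S (fun i => p i * r i) hk, add_sub_cancel_left]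
      rw [h1, h2]
      simp only [Finset.mul_sum, ← Finset.sum_add_distrib]
      exact Finset.sum_congr rfl fun _ _ => by ring
    have hne : (S.erase k).Nonempty := by
      by_contra h
      rw [Finset.not_nonempty_iff_eq_empty.1 h, Finset.sum_empty] at hrow
      linarith
    have hlin : r k * (1 - 2 * b + 4 * b * p k) < 2 * b * (1 - b + b * p k) := by
      have := Finset.sum_lt_sum_of_nonempty hne hlt
      rw [← hrow, hbound] at this
      linarith
    have hD : 0 < 1 - 2 * b + 4 * b * p k := by nlinarith [mul_pos hb0 hpk]
    refine lt_of_mul_lt_mul_right ?_ hD.le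
    have hmul := mul_lt_mul_of_pos_left hlin hpk
    have hsq : ((1 - b) / 4 + b * p k) * (1 - 2 * b + 4 * b * p k) =
        p k * (2 * b * (1 - b + b * p k)) + 2 * b ^ 2 * (p k - 1 / 4) ^ 2 := by
      linear_combination (1 / 8 : ℝ) * hb
    nlinarith [mul_nonneg (sq_nonneg b) (sq_nonneg (p k - 1 / 4))]
  have hne : S.Nonempty := by
    by_contra h
    simp [Finset.not_nonempty_iff_eq_empty.1 h] at hp1
  have hsum := Finset.sum_lt_sum_of_nonempty hne key
  rw [hpr, Finset.sum_add_distrib, Finset.sum_const, ← Finset.mul_sum, hp1, nsmul_eq_mul] at hsum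
  have : (S.card : ℝ) ≤ 4 := by exact_mod_cast hS
  nlinarith

/-- If `ν` is at most both eigenvalues of `Aᴴ * A` for a `2 × 2` matrix `A`, expressed through the
trace and the determinant, then `ν ‖y‖² ≤ ‖A y‖²`. -/
lemma mul_normSq_le_normSq_mulVec (a b c d x y : ℂ) {ν : ℝ}
    (htr : 2 * ν ≤ Complex.normSq a + Complex.normSq b + (Complex.normSq c + Complex.normSq d))
    (hdet : ν * (Complex.normSq a + Complex.normSq b + (Complex.normSq c + Complex.normSq d)) - ν ^ 2
      ≤ Complex.normSq (a * d - b * c)) :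
    ν * (Complex.normSq x + Complex.normSq y) ≤
      Complex.normSq (a * x + b * y) + Complex.normSq (c * x + d * y) := by
  set P := Complex.normSq a + Complex.normSq c - ν with hP
  set Q := Complex.normSq b + Complex.normSq d - ν with hQ
  set z := (starRingEnd ℂ) a * b + (starRingEnd ℂ) c * d with hz
  have hPQ : Complex.normSq z ≤ P * Q := by
    have : P * Q - Complex.normSq z = Complex.normSq (a * d - b * c) -
        (ν * (Complex.normSq a + Complex.normSq b + (Complex.normSq c + Complex.normSq d)) - ν ^ 2) := by
      simp only [hP, hQ, hz, Complex.normSq_apply, Complex.add_re, Complex.add_im, Complex.sub_re,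
        Complex.sub_im, Complex.mul_re, Complex.mul_im, Complex.conj_re, Complex.conj_im]
      ring
    linarith
  have hPQ0 : 0 ≤ P * Q := (Complex.normSq_nonneg z).trans hPQ
  have hsum : 0 ≤ P + Q := by rw [hP, hQ]; linarith
  have hP0 : 0 ≤ P := by nlinarith
  have hQ0 : 0 ≤ Q := by nlinarith
  have hexp : Complex.normSq (a * x + b * y) + Complex.normSq (c * x + d * y) -
      ν * (Complex.normSq x + Complex.normSq y) =
      P * Complex.normSq x + Q * Complex.normSq y +
        2 * (z * ((starRingEnd ℂ) x * y)).re := by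
    simp only [hP, hQ, hz, Complex.normSq_apply, Complex.add_re, Complex.add_im,
      Complex.mul_re, Complex.mul_im, Complex.conj_re, Complex.conj_im]
    ring
  have hre : (z * ((starRingEnd ℂ) x * y)).re ^ 2 ≤
      (P * Complex.normSq x) * (Q * Complex.normSq y) := by
    calc _ ≤ Complex.normSq (z * ((starRingEnd ℂ) x * y)) := by
          rw [Complex.normSq_apply]; nlinarith [mul_self_nonneg (z * ((starRingEnd ℂ) x * y)).im]
      _ = Complex.normSq z * (Complex.normSq x * Complex.normSq y) := by
          simp [Complex.normSq_mul, Complex.normSq_conj]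
      _ ≤ P * Q * (Complex.normSq x * Complex.normSq y) :=
          mul_le_mul_of_nonneg_right hPQ
            (mul_nonneg (Complex.normSq_nonneg _) (Complex.normSq_nonneg _))
      _ = _ := by ring
  have hX := mul_nonneg hP0 (Complex.normSq_nonneg x)
  have hY := mul_nonneg hQ0 (Complex.normSq_nonneg y)
  have habs : (-(2 * (z * ((starRingEnd ℂ) x * y)).re)) ≤
      P * Complex.normSq x + Q * Complex.normSq y := by
    refine le_of_abs_le (abs_le_of_sq_le_sq ?_ (add_nonneg hX hY))
    nlinarith [sq_nonneg (P * Complex.normSq x - Q * Complex.normSq y)]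
  linarith

/-- A bound on the operator norm of the inverse of a `2 × 2` matrix from a lower bound on the
eigenvalues of `Aᴴ * A`. -/
lemma norm_toEuclideanCLM_inv_le (A : Matrix (Fin 2) (Fin 2) ℂ) {ν : ℝ} (hν : 0 < ν)
    (htr : 2 * ν ≤ Complex.normSq (A 0 0) + Complex.normSq (A 0 1) +
      (Complex.normSq (A 1 0) + Complex.normSq (A 1 1)))
    (hdet : ν * (Complex.normSq (A 0 0) + Complex.normSq (A 0 1) +
      (Complex.normSq (A 1 0) + Complex.normSq (A 1 1))) - ν ^ 2 ≤ Complex.normSq A.det) :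
    IsUnit A.det ∧ ‖Matrix.toEuclideanCLM (𝕜 := ℂ) A⁻¹‖ ≤ Real.sqrt (1 / ν) := by
  have hu : IsUnit A.det := by
    rw [isUnit_iff_ne_zero, ← Complex.normSq_pos]
    nlinarith
  refine ⟨hu, ContinuousLinearMap.opNorm_le_bound _ (Real.sqrt_nonneg _) fun x => ?_⟩
  set w := Matrix.toEuclideanCLM (𝕜 := ℂ) A⁻¹ x with hw
  have hAw : Matrix.toEuclideanCLM (𝕜 := ℂ) A w = x := by
    rw [hw, ← mul_apply_eq_comp, ← map_mul, Matrix.mul_nonsing_inv _ hu, map_one]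
    rfl
  have hx : ∀ k, x k = A k 0 * w 0 + A k 1 * w 1 := by
    intro k
    conv_lhs => rw [← hAw]
    simp [Matrix.mulVec, dotProduct, Fin.sum_univ_two]
  rw [Matrix.det_fin_two] at hdet
  have h := mul_normSq_le_normSq_mulVec _ _ _ _ (w 0) (w 1) htr hdet
  rw [← hx, ← hx] at h
  have hsq : ∀ u : EuclideanSpace ℂ (Fin 2),
      ‖u‖ ^ 2 = Complex.normSq (u 0) + Complex.normSq (u 1) := by
    intro u
    rw [EuclideanSpace.norm_sq_eq, Fin.sum_univ_two, Complex.normSq_eq_norm_sq,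
      Complex.normSq_eq_norm_sq]
  rw [← hsq, ← hsq] at h
  refine le_of_abs_le (abs_le_of_sq_le_sq ?_ (by positivity))
  rw [mul_pow, Real.sq_sqrt (by positivity), one_div, ← div_eq_inv_mul, le_div_iff₀ hν]
  linarith

/-- The Bloch vector of a row vector in `ℂ²`. -/
def blochVector (a b : ℂ) : Fin 3 → ℝ :=
  ![2 * (a.re * b.re + a.im * b.im), 2 * (a.im * b.re - a.re * b.im),
    Complex.normSq a - Complex.normSq b]

lemma blochVector_dotProduct (a b c d : ℂ) :
    (Complex.normSq a + Complex.normSq b) * (Complex.normSq c + Complex.normSq d) -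
      blochVector a b ⬝ᵥ blochVector c d = 2 * Complex.normSq (a * d - b * c) := by
  simp only [blochVector, dotProduct, Fin.sum_univ_three, Matrix.cons_val, Complex.normSq_apply,
    Complex.sub_re, Complex.sub_im, Complex.mul_re, Complex.mul_im]
  ring

lemma sum_blochVector_eq_zero {n : ℕ} (U : Matrix (Fin n) (Fin 2) ℂ) (hU : Uᴴ * U = 1) :
    ∑ i, blochVector (U i 0) (U i 1) = 0 := by
  have h00 := congrArg Complex.re (congrFun (congrFun hU 0) 0)
  have h11 := congrArg Complex.re (congrFun (congrFun hU 1) 1)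
  have h01 := congrFun (congrFun hU 0) 1
  have hre := congrArg Complex.re h01
  have him := congrArg Complex.im h01
  simp [Matrix.mul_apply, Complex.mul_re, Complex.mul_im] at h00 h11 hre him
  funext k
  fin_cases k
  · simp only [blochVector, Finset.sum_apply]
    simp [← Finset.mul_sum, hre]
  · simp only [blochVector, Finset.sum_apply]
    simp only [Fin.mk_one, Matrix.cons_val, ← Finset.mul_sum]
    simp only [Finset.sum_sub_distrib, Finset.sum_add_distrib, Finset.sum_neg_distrib] at him ⊢
    simp
    linarith
  · simp only [blochVector, Finset.sum_apply]
    simp [Complex.normSq_apply, h00, h11]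

lemma sum_normSq_eq_two {n : ℕ} (U : Matrix (Fin n) (Fin 2) ℂ) (hU : Uᴴ * U = 1) :
    ∑ i, (Complex.normSq (U i 0) + Complex.normSq (U i 1)) = 2 := by
  have h00 := congrArg Complex.re (congrFun (congrFun hU 0) 0)
  have h11 := congrArg Complex.re (congrFun (congrFun hU 1) 1)
  simp [Matrix.mul_apply, Complex.mul_re] at h00 h11
  simp only [Complex.normSq_apply, Finset.sum_add_distrib] at *
  linarith

/-- For every integer `n ≥ 3` and every complex `n × 2` matrix `U` with
orthonormal columns (`Uᴴ * U = 1`), there exist indices `i ≠ j` such that the `2 × 2`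
submatrix formed by rows `i` and `j` of `U` is invertible and the spectral norm of its
inverse is at most `√(n / α)`, where `α = 2 - 2/√3`. -/
theorem submatrix_inverse_spectral_norm_bound
    (n : ℕ) (hn : 3 ≤ n) (U : Matrix (Fin n) (Fin 2) ℂ) (hU : Uᴴ * U = 1) :
    ∃ i j : Fin n, i ≠ j ∧ IsUnit (U.submatrix ![i, j] id).det ∧
      ‖Matrix.toEuclideanCLM (𝕜 := ℂ) ((U.submatrix ![i, j] id)⁻¹)‖ ≤
        Real.sqrt (n / (2 - 2 / Real.sqrt 3)) := by
  have hn0 : (0 : ℝ) < n := by exact_mod_cast (by omega : 0 < n)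
  set R : Fin n → ℝ := fun i => Complex.normSq (U i 0) + Complex.normSq (U i 1) with hR
  set V : Fin n → Fin 3 → ℝ := fun i => blochVector (U i 0) (U i 1) with hV
  have hR0 : ∀ i, 0 ≤ R i := fun i => add_nonneg (Complex.normSq_nonneg _) (Complex.normSq_nonneg _)
  have hRV : ∀ i, R i ^ 2 = V i ⬝ᵥ V i := by
    intro i
    have := blochVector_dotProduct (U i 0) (U i 1) (U i 0) (U i 1)
    rw [mul_comm (U i 1), sub_self, map_zero, mul_zero] at this
    rw [pow_two]
    exact sub_eq_zero.1 this
  obtain ⟨p, hp0, hp1, hpv, hpr, hcard⟩ :=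
    exists_weights_card_support_le V R (fun _ => 1 / (n : ℝ)) (fun _ => by positivity)
  rw [← Finset.smul_sum, sum_blochVector_eq_zero U hU, smul_zero] at hpv
  rw [← Finset.mul_sum, sum_normSq_eq_two U hU] at hpr
  have hp1' : ∑ i, p i = 1 := by rw [hp1]; simp [hn0.ne']
  set S := Finset.univ.filter fun i => p i ≠ 0 with hS
  have hsupp : ∀ i ∉ S, p i = 0 := fun i hi => by simpa [hS] using hi
  set κ := ∑ i, p i * R i with hκ
  have hκ0 : 0 < κ := lt_of_lt_of_le (by positivity) hpr
  set s := Real.sqrt 3 with hs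
  have hs2 : s ^ 2 = 3 := Real.sq_sqrt (by norm_num)
  have hs0 : 0 < s := Real.sqrt_pos.2 (by norm_num)
  have hs1 : 1 < s := by nlinarith
  have hs3 : s < 2 := by nlinarith
  have hb0 : 0 < 1 - 1 / s := by rw [sub_pos, div_lt_one hs0]; exact hs1
  have hb1 : 1 - 1 / s < 1 / 2 := by
    have : 1 / 2 < 1 / s := one_div_lt_one_div_of_lt hs0 hs3
    linarith
  have hb : 3 * (1 - (1 - 1 / s)) ^ 2 = 1 := by
    field_simp
    linarith
  have hα : 2 - 2 / s = 2 * (1 - 1 / s) := by ring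
  rw [hα]
  set b := 1 - 1 / s
  obtain ⟨i, -, j, -, hij, hi, hj, hG⟩ := exists_pair_of_card_le_four S hcard
    (fun i => κ⁻¹ • V i) (fun i => κ⁻¹ * R i) p (fun i => mul_nonneg (by positivity) (hR0 i))
    (fun i => by simp [mul_pow, hRV]; ring)
    (fun i hi => lt_of_le_of_ne (hp0 i) (Ne.symm (by simpa [hS] using hi)))
    (by rw [← hp1']; exact Finset.sum_subset (Finset.subset_univ S) fun i _ hi => hsupp i hi)
    (by
      rw [Finset.sum_subset (Finset.subset_univ S) fun i _ hi => by simp [hsupp i hi]]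
      simp only [smul_comm _ κ⁻¹, ← Finset.smul_sum, hpv, smul_zero])
    (by
      rw [Finset.sum_subset (Finset.subset_univ S) fun i _ hi => by simp [hsupp i hi]]
      simp only [mul_left_comm _ κ⁻¹, ← Finset.mul_sum, ← hκ]
      exact inv_mul_cancel₀ hκ0.ne')
    hb0 hb1 hb
  have hi' : b * κ ≤ R i := by rwa [inv_mul_eq_div, le_div_iff₀ hκ0] at hi
  have hj' : b * κ ≤ R j := by rwa [inv_mul_eq_div, le_div_iff₀ hκ0] at hj
  have hdet : b * κ * (R i + R j) - (b * κ) ^ 2 ≤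
      Complex.normSq (U i 0 * U j 1 - U i 1 * U j 0) := by
    have h2 : R i * R j - V i ⬝ᵥ V j = 2 * Complex.normSq (U i 0 * U j 1 - U i 1 * U j 0) :=
      blochVector_dotProduct _ _ _ _
    simp only [smul_dotProduct, dotProduct_smul, smul_eq_mul] at hG
    have h3 := mul_le_mul_of_nonneg_left hG (sq_nonneg κ)
    have e1 : κ ^ 2 * (2 * b * (κ⁻¹ * R i + κ⁻¹ * R j) - 2 * b ^ 2) =
        2 * (b * κ * (R i + R j) - (b * κ) ^ 2) := by field_simp
    have e2 : κ ^ 2 * (κ⁻¹ * R i * (κ⁻¹ * R j) - κ⁻¹ * (κ⁻¹ * (V i ⬝ᵥ V j))) =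
        R i * R j - V i ⬝ᵥ V j := by field_simp
    rw [e1, e2, h2] at h3
    linarith
  obtain ⟨hu, hnorm⟩ := norm_toEuclideanCLM_inv_le (U.submatrix ![i, j] id) (mul_pos hb0 hκ0)
    (by simp only [submatrix_apply, id, Matrix.cons_val]; linarith)
    (by
      rw [Matrix.det_fin_two]
      simp only [submatrix_apply, id, Matrix.cons_val]
      exact hdet)
  refine ⟨i, j, hij, hu, hnorm.trans (Real.sqrt_le_sqrt ?_)⟩
  have hκn : 2 ≤ κ * n := by
    rw [one_div_mul_eq_div, div_le_iff₀ hn0] at hpr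
    exact hpr
  rw [div_le_div_iff₀ (mul_pos hb0 hκ0) (by positivity)]
  nlinarith
end

section
/- Let n ≥ 3 and let w₁, …, w_n be vectors in ℝ³ with ∑ᵢ wᵢ = 0 and ∑ᵢ |wᵢ| = 2 (i.e., they form a closed polygon of perimeter 2). Then max over pairs i ≠ j of (|wᵢ| + |wⱼ| − |wᵢ + wⱼ|) is at least 2α/n, where α = 2 − 2/√3. -/
open Finset in
/-- Carathéodory reduction: nonnegative weights can be moved to at most `finrank + 1` indices,
keeping the total weight and the weighted sum of the vectors, without decreasing a given
linear functional of the weights. -/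
theorem exists_weights_card_support_le_s2 {ι E : Type*} [Fintype ι] [AddCommGroup E] [Module ℝ E]
    [FiniteDimensional ℝ E] (w : ι → E) (l : ι → ℝ) (c : ι → ℝ) (hc : ∀ i, 0 ≤ c i) :
    ∃ c' : ι → ℝ, (∀ i, 0 ≤ c' i) ∧ ∑ i, c' i = ∑ i, c i ∧ ∑ i, c' i • w i = ∑ i, c i • w i ∧
      ∑ i, c i * l i ≤ ∑ i, c' i * l i ∧ #{i | c' i ≠ 0} ≤ Module.finrank ℝ E + 1 := by
  induction hN : #{i | c i ≠ 0} using Nat.strong_induction_on generalizing c with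
  | _ N ih =>
  by_cases hcard : N ≤ Module.finrank ℝ E + 1
  · exact ⟨c, hc, rfl, rfl, le_rfl, hN ▸ hcard⟩
  obtain ⟨μ, hμsupp, hμ0, hμw, hμ1⟩ : ∃ μ : ι → ℝ, (∀ i, c i = 0 → μ i = 0) ∧ μ ≠ 0 ∧
      ∑ i, μ i • w i = 0 ∧ ∑ i, μ i = 0 := by
    let A : (ι → ℝ) →ₗ[ℝ] E × ℝ :=
      (∑ i, (LinearMap.proj i).smulRight (w i)).prod (∑ i, LinearMap.proj i)
    let B : ({i // c i ≠ 0} → ℝ) →ₗ[ℝ] (ι → ℝ) := Function.ExtendByZero.linearMap ℝ Subtype.val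
    have hlt : Module.finrank ℝ (E × ℝ) < Module.finrank ℝ ({i // c i ≠ 0} → ℝ) := by
      rw [Module.finrank_prod, Module.finrank_self, Module.finrank_fintype_fun_eq_card,
        Fintype.card_subtype, hN]
      omega
    obtain ⟨x, hx, hx0⟩ := (Submodule.ne_bot_iff _).1
      (LinearMap.ker_ne_bot_of_finrank_lt (f := A ∘ₗ B) hlt)
    have hAB : A (B x) = 0 := hx
    refine ⟨B x, fun i hi ↦ ?_, fun h ↦ hx0 ?_, ?_, ?_⟩
    · exact Function.extend_apply' _ _ _ (by rintro ⟨⟨j, hj⟩, rfl⟩; exact hj hi)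
    · funext i
      exact (Subtype.val_injective.extend_apply x 0 i).symm.trans (congrFun h i)
    · simpa [A] using congrArg Prod.fst hAB
    · simpa [A] using congrArg Prod.snd hAB
  wlog hμl : 0 ≤ ∑ i, μ i * l i generalizing μ
  · refine this (-μ) (fun i hi ↦ by simp [hμsupp i hi]) (neg_ne_zero.2 hμ0) (by simp [hμw])
      (by simp [hμ1]) ?_
    simp only [Pi.neg_apply, neg_mul, sum_neg_distrib]
    linarith
  have hneg : ({i | μ i < 0} : Finset ι).Nonempty := by
    by_contra h
    rw [not_nonempty_iff_eq_empty, filter_eq_empty_iff] at h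
    refine hμ0 (funext fun i ↦ ?_)
    exact (sum_eq_zero_iff_of_nonneg fun j hj ↦ not_lt.1 (h hj)).1 hμ1 i (mem_univ i)
  obtain ⟨k, hk, hmin⟩ := exists_min_image _ (fun i ↦ c i / -μ i) hneg
  rw [mem_filter] at hk
  set t := c k / -μ k with ht
  have ht0 : 0 ≤ t := div_nonneg (hc k) (by linarith)
  let c₁ : ι → ℝ := fun i ↦ c i + t * μ i
  have hc₁ : ∀ i, 0 ≤ c₁ i := fun i ↦ by
    rcases lt_or_ge (μ i) 0 with hi | hi
    · have := hmin i (by simp [hi])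
      rw [le_div_iff₀ (by linarith)] at this
      simp only [c₁]
      linarith
    · exact add_nonneg (hc i) (mul_nonneg ht0 hi)
  have hlt : #{i | c₁ i ≠ 0} < N := by
    rw [← hN]
    refine card_lt_card ((ssubset_iff_of_subset fun i hi ↦ ?_).2 ⟨k, ?_, ?_⟩)
    · simp only [mem_filter, mem_univ, true_and] at hi ⊢
      exact fun h ↦ hi (by simp [c₁, h, hμsupp i h])
    · simp only [mem_filter, mem_univ, true_and]
      exact fun h ↦ hk.2.ne (hμsupp k h)
    · have : μ k ≠ 0 := hk.2.ne
      simp only [mem_filter, mem_univ, true_and, not_not, c₁, ht]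
      field_simp
      ring
  obtain ⟨c', h0, h1, hw, hl, hcard'⟩ := ih _ hlt c₁ hc₁ rfl
  refine ⟨c', h0, ?_, ?_, le_trans ?_ hl, hcard'⟩
  · rw [h1]
    simp only [c₁, sum_add_distrib, ← mul_sum, hμ1, mul_zero, add_zero]
  · rw [hw]
    simp only [c₁, add_smul, sum_add_distrib, mul_smul, ← smul_sum, hμw, smul_zero, add_zero]
  · simp only [c₁, add_mul, sum_add_distrib, mul_assoc, ← mul_sum]
    exact le_add_of_nonneg_right (mul_nonneg ht0 hμl)

section InnerProductSpace

variable {E : Type*} [NormedAddCommGroup E] [InnerProductSpace ℝ E]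

theorem sub_mul_sub_sub_inner_le {x y : E} {D : ℝ} (hx : D / 2 ≤ ‖x‖)
    (h : ‖x‖ + ‖y‖ - ‖x + y‖ ≤ D) :
    (‖x‖ - D) * (‖y‖ - D) - inner ℝ x y ≤ D ^ 2 / 2 := by
  rcases lt_or_ge ‖y‖ (D / 2) with hy | hy
  · have := neg_le_of_abs_le (abs_real_inner_le_norm x y)
    nlinarith [mul_nonneg (sub_nonneg.2 hx) (sub_nonneg.2 hy.le)]
  · have h1 := norm_add_sq_real x y
    have h2 : (‖x‖ + ‖y‖ - D) ^ 2 ≤ ‖x + y‖ ^ 2 := pow_le_pow_left₀ (by linarith) (by linarith) 2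
    nlinarith

/-- If all pairwise defects are at most `D`, a long vector carries little weight. -/
theorem weight_mul_le {ι : Type*} [Fintype ι] {w : ι → E} {c : ι → ℝ} (hc : ∀ i, 0 ≤ c i)
    (hc1 : ∑ i, c i = 1) (hcw : ∑ i, c i • w i = 0) {D : ℝ}
    (h : ∀ i j, i ≠ j → ‖w i‖ + ‖w j‖ - ‖w i + w j‖ ≤ D) {i : ι} (hi : D / 2 ≤ ‖w i‖) :
    c i * (2 * D * ‖w i‖ - D ^ 2 / 2) ≤
      D ^ 2 / 2 - (‖w i‖ - D) * (∑ j, c j * ‖w j‖ - D) := by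
  classical
  have hsum : ∑ j, c j * ((‖w i‖ - D) * (‖w j‖ - D) - inner ℝ (w i) (w j)) =
      (‖w i‖ - D) * (∑ j, c j * ‖w j‖ - D) := by
    have h0 : ∑ j, c j * inner ℝ (w i) (w j) = 0 := by
      simp_rw [← real_inner_smul_right, ← inner_sum, hcw, inner_zero_right]
    have h2 : ∑ j, c j * ((‖w i‖ - D) * (‖w j‖ - D) - inner ℝ (w i) (w j)) =
        (‖w i‖ - D) * (∑ j, c j * ‖w j‖ - (∑ j, c j) * D) - ∑ j, c j * inner ℝ (w i) (w j) := by
      rw [Finset.sum_mul, ← Finset.sum_sub_distrib, Finset.mul_sum, ← Finset.sum_sub_distrib]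
      exact Finset.sum_congr rfl fun j _ ↦ by ring
    rw [h2, h0, hc1]
    ring
  have hle : ∑ j, c j * ((‖w i‖ - D) * (‖w j‖ - D) - inner ℝ (w i) (w j)) ≤
      ∑ j, (c j * (D ^ 2 / 2) + if j = i then c i * (D ^ 2 / 2 - 2 * D * ‖w i‖) else 0) := by
    refine Finset.sum_le_sum fun j _ ↦ ?_
    split_ifs with hj
    · subst hj
      rw [real_inner_self_eq_norm_sq]
      exact le_of_eq (by ring)
    · rw [add_zero]
      exact mul_le_mul_of_nonneg_left (sub_mul_sub_sub_inner_le hi (h i j (Ne.symm hj))) (hc j)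
  rw [hsum, Finset.sum_add_distrib, ← Finset.sum_mul, hc1, Finset.sum_ite_eq' Finset.univ i] at hle
  simp only [Finset.mem_univ, if_true] at hle
  linarith

end InnerProductSpace

theorem mul_sub_half_lt {a c m D : ℝ} (hD : 0 < D) (hm : D < (2 - 2 / √3) * m) (ha : D / 2 ≤ a)
    (h : c * (2 * D * a - D ^ 2 / 2) ≤ D ^ 2 / 2 - (a - D) * (m - D)) :
    c * (a - D / 2) < (m - D / 2) / 4 := by
  have hs : √3 ^ 2 = 3 := Real.sq_sqrt (by norm_num)
  have hs1 : 1 < √3 := by nlinarith [Real.sqrt_nonneg 3]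
  have hy : D * (1 + √3) / 4 < m - D / 2 := by
    have h1 : 2 - 2 / √3 = 2 * (√3 - 1) / √3 := by field_simp
    rw [h1, div_mul_eq_mul_div, lt_div_iff₀ (by linarith)] at hm
    nlinarith [mul_lt_mul_of_pos_right hm (show 0 < √3 + 1 by linarith)]
  obtain ⟨x, rfl⟩ : ∃ x, a = x + D / 2 := ⟨a - D / 2, by ring⟩
  obtain ⟨y, rfl⟩ : ∃ y, m = y + D / 2 := ⟨m - D / 2, by ring⟩
  simp only [add_sub_cancel_right] at hy ⊢
  have hx : 0 ≤ x := by linarith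
  have hpos : 0 < 2 * D * x + D ^ 2 / 2 := by positivity
  have hkey : x * D ^ 2 + 2 * x ^ 2 * D < y * (4 * x ^ 2 + D ^ 2 / 2) := by
    have h1 : D * (1 + √3) / 4 * (4 * x ^ 2 + D ^ 2 / 2) < y * (4 * x ^ 2 + D ^ 2 / 2) :=
      mul_lt_mul_of_pos_right hy (by positivity)
    have h2 : 0 ≤ D * ((√3 - 1) * (x - D * (1 + √3) / 4) ^ 2) := by
      have := sub_pos.2 hs1
      positivity
    have h3 : D * ((√3 - 1) * (x - D * (1 + √3) / 4) ^ 2) =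
        D * (1 + √3) / 4 * (4 * x ^ 2 + D ^ 2 / 2) - (x * D ^ 2 + 2 * x ^ 2 * D) := by
      linear_combination (D ^ 3 * (√3 + 1) / 16 - D ^ 2 * x / 2) * hs
    linarith
  refine lt_of_mul_lt_mul_right ?_ hpos.le
  nlinarith [mul_le_mul_of_nonneg_left h hx]

open Finset in
/-- Weighted version: nonnegative weights of total mass `1` on at most four indices, balancing the
vectors, force a pair with large defect. -/
theorem defect_bound_of_card_support_le_four {ι E : Type*} [Fintype ι] [NormedAddCommGroup E]
    [InnerProductSpace ℝ E] {w : ι → E} {c : ι → ℝ} (hc : ∀ i, 0 ≤ c i) (hc1 : ∑ i, c i = 1)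
    (hcw : ∑ i, c i • w i = 0) (hcard : #{i | c i ≠ 0} ≤ 4) {D : ℝ} (hD : 0 < D)
    (h : ∀ i j, i ≠ j → ‖w i‖ + ‖w j‖ - ‖w i + w j‖ ≤ D) :
    (2 - 2 / √3) * ∑ i, c i * ‖w i‖ ≤ D := by
  by_contra! hm
  set m := ∑ i, c i * ‖w i‖ with hm_def
  have hm0 : 0 < m - D / 2 := by
    have h1 : 0 < 2 / √3 := by positivity
    have h2 : 0 ≤ m := sum_nonneg fun i _ ↦ mul_nonneg (hc i) (norm_nonneg _)
    nlinarith [mul_nonneg h1.le h2]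
  have hlt : ∀ i, c i * (‖w i‖ - D / 2) < (m - D / 2) / 4 := fun i ↦ by
    rcases lt_or_ge ‖w i‖ (D / 2) with hi | hi
    · exact (mul_nonpos_of_nonneg_of_nonpos (hc i) (by linarith)).trans_lt (by linarith)
    · exact mul_sub_half_lt hD hm hi (weight_mul_le hc hc1 hcw h hi)
  have hsum : ∑ i with c i ≠ 0, c i * (‖w i‖ - D / 2) = m - D / 2 := by
    rw [sum_filter_of_ne fun i _ hi ↦ left_ne_zero_of_mul hi]
    simp only [mul_sub, sum_sub_distrib, ← sum_mul, hc1, one_mul, ← hm_def]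
  have hne : ({i | c i ≠ 0} : Finset ι).Nonempty := by
    by_contra hne
    rw [not_nonempty_iff_eq_empty.1 hne, sum_empty] at hsum
    linarith
  have hbound := sum_lt_sum_of_nonempty hne fun i _ ↦ hlt i
  rw [hsum, sum_const, nsmul_eq_mul] at hbound
  have h4 : (#{i | c i ≠ 0} : ℝ) ≤ 4 := by exact_mod_cast hcard
  nlinarith

/-- If `w₁, …, wₙ ∈ ℝ³` (`n ≥ 3`) satisfy `∑ wᵢ = 0` and `∑ ‖wᵢ‖ = 2`,
then `max_{i ≠ j} (‖wᵢ‖ + ‖wⱼ‖ - ‖wᵢ + wⱼ‖) ≥ 2α/n`, where `α = 2 - 2/√3`. -/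
theorem exists_pair_perimeter_defect_ge
    (n : ℕ) (hn : 3 ≤ n) (w : Fin n → EuclideanSpace ℝ (Fin 3))
    (hsum : ∑ i, w i = 0) (hper : ∑ i, ‖w i‖ = 2) :
    ∃ i j : Fin n, i ≠ j ∧
      2 * (2 - 2 / Real.sqrt 3) / n ≤ ‖w i‖ + ‖w j‖ - ‖w i + w j‖ := by
  have hn0 : (0 : ℝ) < n := by exact_mod_cast (by omega : 0 < n)
  have hα : 0 < 2 - 2 / √3 := by
    have hs1 : 1 < √3 := by rw [Real.lt_sqrt] <;> norm_num
    rw [sub_pos, div_lt_iff₀ (by linarith)]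
    linarith
  obtain ⟨c, hc, hc1, hcw, hcl, hcard⟩ := exists_weights_card_support_le_s2 w (fun i ↦ ‖w i‖)
    (fun _ ↦ (n : ℝ)⁻¹) (fun _ ↦ by positivity)
  rw [Finset.sum_const, Finset.card_univ, Fintype.card_fin, nsmul_eq_mul,
    mul_inv_cancel₀ hn0.ne'] at hc1
  rw [← Finset.smul_sum, hsum, smul_zero] at hcw
  rw [← Finset.mul_sum, hper] at hcl
  rw [finrank_euclideanSpace_fin] at hcard
  obtain ⟨⟨i, j⟩, hij, hmax⟩ := Finset.exists_max_image (Finset.univ : Finset (Fin n)).offDiag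
    (fun p ↦ ‖w p.1‖ + ‖w p.2‖ - ‖w p.1 + w p.2‖)
    ⟨(⟨0, by omega⟩, ⟨1, by omega⟩), by simp⟩
  refine ⟨i, j, by simpa using hij, ?_⟩
  by_contra! hlt
  have hα' : 0 < 2 * (2 - 2 / √3) / n := by positivity
  obtain ⟨D, hD, hDα⟩ := exists_between (max_lt hlt hα')
  have hbound := defect_bound_of_card_support_le_four hc hc1 hcw hcard
    ((le_max_right _ _).trans_lt hD) fun i' j' h ↦
      (hmax (i', j') (by simpa using h)).trans ((le_max_left _ _).trans hD.le)
  have : 2 * (2 - 2 / √3) / n ≤ (2 - 2 / √3) * ∑ i, c i * ‖w i‖ := by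
    refine le_trans (le_of_eq ?_) (mul_le_mul_of_nonneg_left hcl hα.le)
    ring
  linarith
end
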